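/- arXiv:1610.07543 — 13 statements merged into one kernel-verified Lean document; each statement's English description precedes it below -/
import Mathlib

section
/- Let n ≥ 1 and let q, d ∈ ℝⁿ be probability vectors. Let α ≥ 0 and let S ⊆ {1,…,n}; write q̄ = Σ_{j∈S} q_j, d̄ = Σ_{j∈S} d_j and C = (q̄(e^α − 1) + 1)/(d̄(e^α − 1) + 1). Assume that for every j ∈ S one has q_j · (d̄(e^α − 1) + 1) > d_j · (q̄(e^α − 1) + 1), and for every k ∉ S one has q_k · (d̄(e^α − 1) + 1) ≤ d_k · (q̄(e^α − 1) + 1). Then C is the maximum value of the ratio (Σᵢ q_i x_i)/(Σᵢ d_i x_i) over the feasible region F(α): every x ∈ F(α) satisfies (Σᵢ q_i x_i)/(Σᵢ d_i x_i) ≤ C, and some x ∈ F(α) attains the value C. -/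
open Real Finset

/-- The feasible region F(α): all vectors `x` with `0 < x i < 1` for every `i`
and `x j ≤ e^α * x k` for every pair of indices. -/
def feasible (n : ℕ) (α : ℝ) : Set (Fin n → ℝ) :=
  {x | (∀ i, 0 < x i ∧ x i < 1) ∧ ∀ j k, x j ≤ Real.exp α * x k}

/-- Splitting a weighted sum of the two-level vector equal to `a` on `S` and `t` off `S`. -/
theorem sum_mul_two_level {ι : Type*} [Fintype ι] [DecidableEq ι] (w : ι → ℝ) (S : Finset ι)
    (a t : ℝ) :
    ∑ i, w i * (if i ∈ S then a else t) = (∑ i ∈ S, w i) * (a - t) + (∑ i, w i) * t := by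
  have h : ∀ i, w i * (if i ∈ S then a else t) = (if i ∈ S then w i else 0) * (a - t) + w i * t := by
    intro i
    split_ifs <;> ring
  simp only [h, Finset.sum_add_distrib, ← Finset.sum_mul, Finset.sum_ite_mem, Finset.univ_inter]

theorem stmt_0 (n : ℕ) (hn : 1 ≤ n) (q d : Fin n → ℝ)
    (hq0 : ∀ i, 0 ≤ q i) (hq1 : ∑ i, q i = 1)
    (hd0 : ∀ i, 0 ≤ d i) (hd1 : ∑ i, d i = 1)
    (α : ℝ) (hα : 0 ≤ α) (S : Finset (Fin n))
    (C : ℝ)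
    (hC : C = ((∑ j ∈ S, q j) * (Real.exp α - 1) + 1) /
              ((∑ j ∈ S, d j) * (Real.exp α - 1) + 1))
    (hin : ∀ j ∈ S,
      q j * ((∑ j ∈ S, d j) * (Real.exp α - 1) + 1) >
      d j * ((∑ j ∈ S, q j) * (Real.exp α - 1) + 1))
    (hout : ∀ k ∉ S,
      q k * ((∑ j ∈ S, d j) * (Real.exp α - 1) + 1) ≤
      d k * ((∑ j ∈ S, q j) * (Real.exp α - 1) + 1)) :
    (∀ x ∈ feasible n α, (∑ i, q i * x i) / (∑ i, d i * x i) ≤ C) ∧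
    (∃ x ∈ feasible n α, (∑ i, q i * x i) / (∑ i, d i * x i) = C) := by
  set E := Real.exp α with hE
  have hE1 : 1 ≤ E := Real.one_le_exp hα
  have hE0 : 0 < E := Real.exp_pos α
  set Q := ∑ j ∈ S, q j
  set D := ∑ j ∈ S, d j
  have hD0 : 0 ≤ D := Finset.sum_nonneg fun i _ => hd0 i
  have hB : 0 < D * (E - 1) + 1 := by nlinarith
  constructor
  · rintro x ⟨hx, hxE⟩
    have : Nonempty (Fin n) := ⟨⟨0, hn⟩⟩
    obtain ⟨m, hm⟩ := Finite.exists_min x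
    have hden : 0 < ∑ i, d i * x i := by
      have h : ∑ i, d i * x m ≤ ∑ i, d i * x i :=
        Finset.sum_le_sum fun i _ => mul_le_mul_of_nonneg_left (hm i) (hd0 i)
      rw [← Finset.sum_mul, hd1, one_mul] at h
      exact (hx m).1.trans_le h
    have hle : ∑ i, (q i * (D * (E - 1) + 1) - d i * (Q * (E - 1) + 1)) * x i ≤
        ∑ i, (q i * (D * (E - 1) + 1) - d i * (Q * (E - 1) + 1)) *
          (if i ∈ S then E * x m else x m) := by
      refine Finset.sum_le_sum fun i _ => ?_
      split_ifs with hi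
      · exact mul_le_mul_of_nonneg_left (hxE i m) (sub_nonneg.2 (hin i hi).le)
      · exact mul_le_mul_of_nonpos_left (hm i) (sub_nonpos.2 (hout i hi))
    rw [sum_mul_two_level] at hle
    simp only [sub_mul (q _ * _), mul_right_comm _ _ (x _), Finset.sum_sub_distrib,
      ← Finset.sum_mul, hq1, hd1] at hle
    rw [hC, div_le_div_iff₀ hden hB]
    change _ - _ ≤ (Q * _ - D * _) * _ + _ at hle
    linarith
  · refine ⟨fun i => if i ∈ S then E * (1 / (2 * E)) else 1 / (2 * E), ⟨fun i => ?_, ?_⟩, ?_⟩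
    · have h1 : E * (1 / (2 * E)) = 1 / 2 := by field_simp
      have h2 : 1 / (2 * E) < 1 := by
        rw [div_lt_one (by positivity)]
        linarith
      have h3 : 0 < 1 / (2 * E) := by positivity
      dsimp only
      split_ifs
      · rw [h1]
        norm_num
      · exact ⟨h3, h2⟩
    · intro j k
      have h3 : 0 < 1 / (2 * E) := by positivity
      generalize 1 / (2 * E) = t at h3
      have h4 : t ≤ E * t := le_mul_of_one_le_left h3.le hE1
      have h5 : E * t ≤ E * (E * t) := mul_le_mul_of_nonneg_left h4 hE0.le
      dsimp only
      split_ifs <;> linarith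
    · have h3 : 1 / (2 * E) ≠ 0 := by positivity
      generalize 1 / (2 * E) = t at h3
      rw [sum_mul_two_level, sum_mul_two_level, hq1, hd1, hC,
        ← mul_div_mul_right (Q * (E - 1) + 1) (D * (E - 1) + 1) h3]
      change (Q * _ + _) / (D * _ + _) = _
      congr 1 <;> ring
end

section
/- Let n ≥ 1 and let q, d ∈ ℝⁿ be probability vectors, let α ≥ 0 and let S ⊆ {1,…,n} be nonempty; write q̄ = Σ_{j∈S} q_j and d̄ = Σ_{j∈S} d_j. If for every j ∈ S one has q_j · (d̄(e^α − 1) + 1) > d_j · (q̄(e^α − 1) + 1), and for every k ∉ S one has q_k · (d̄(e^α − 1) + 1) ≤ d_k · (q̄(e^α − 1) + 1), then q̄ > d̄ and moreover q_j > d_j for every j ∈ S. -/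
open Real Finset

theorem stmt_1 (n : ℕ) (hn : 1 ≤ n) (q d : Fin n → ℝ)
    (hq0 : ∀ i, 0 ≤ q i) (hq1 : ∑ i, q i = 1)
    (hd0 : ∀ i, 0 ≤ d i) (hd1 : ∑ i, d i = 1)
    (α : ℝ) (hα : 0 ≤ α) (S : Finset (Fin n)) (hS : S.Nonempty)
    (hin : ∀ j ∈ S,
      q j * ((∑ j ∈ S, d j) * (Real.exp α - 1) + 1) >
      d j * ((∑ j ∈ S, q j) * (Real.exp α - 1) + 1))
    (hout : ∀ k ∉ S,
      q k * ((∑ j ∈ S, d j) * (Real.exp α - 1) + 1) ≤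
      d k * ((∑ j ∈ S, q j) * (Real.exp α - 1) + 1)) :
    (∑ j ∈ S, q j) > (∑ j ∈ S, d j) ∧ ∀ j ∈ S, q j > d j := by
  have ht : 0 ≤ Real.exp α - 1 := sub_nonneg.2 (Real.one_le_exp hα)
  have hD : 0 ≤ ∑ j ∈ S, d j := Finset.sum_nonneg fun i _ => hd0 i
  have hsum := Finset.sum_lt_sum_of_nonempty hS hin
  rw [← Finset.sum_mul, ← Finset.sum_mul] at hsum
  have hlt : ∑ j ∈ S, d j < ∑ j ∈ S, q j := by linarith
  refine ⟨hlt, fun j hj => ?_⟩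
  have hpos : 0 < (∑ j ∈ S, d j) * (Real.exp α - 1) + 1 := by positivity
  refine lt_of_mul_lt_mul_right (lt_of_le_of_lt ?_ (hin j hj)) hpos.le
  have := hd0 j
  gcongr
end

section
/- Let n ≥ 1, let q, d ∈ ℝⁿ be probability vectors and let α ≥ 0. Then there exists a subset S ⊆ {1,…,n} such that, writing q̄ = Σ_{j∈S} q_j and d̄ = Σ_{j∈S} d_j, one has q_j · (d̄(e^α − 1) + 1) > d_j · (q̄(e^α − 1) + 1) for every j ∈ S, and q_k · (d̄(e^α − 1) + 1) ≤ d_k · (q̄(e^α − 1) + 1) for every k ∉ S. -/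
open Real Finset

/-- A real-valued function on a finite type of finsets has a maximizer `S` such that erasing any
element of `S` strictly decreases the value. -/
lemma exists_max_forall_erase_lt {ι : Type*} [Fintype ι] [DecidableEq ι] (R : Finset ι → ℝ) :
    ∃ S : Finset ι, (∀ T, R T ≤ R S) ∧ ∀ j ∈ S, R (S.erase j) < R S := by
  obtain ⟨S₀, -, h₀⟩ := exists_max_image (univ : Finset (Finset ι)) R ⟨∅, mem_univ _⟩
  obtain ⟨S, hS, hmin⟩ := exists_min_image (univ.filter fun T => R T = R S₀) card
    ⟨S₀, by simp⟩
  have hRS : R S = R S₀ := (mem_filter.1 hS).2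
  have hmax : ∀ T, R T ≤ R S := fun T => hRS ▸ h₀ T (mem_univ T)
  refine ⟨S, hmax, fun j hj => lt_of_le_of_ne (hmax _) fun h => ?_⟩
  have hle := hmin (S.erase j) (mem_filter.2 ⟨mem_univ _, h.trans hRS⟩)
  exact absurd (card_erase_lt_of_mem hj) (not_lt.2 hle)

theorem stmt_3 (n : ℕ) (hn : 1 ≤ n) (q d : Fin n → ℝ)
    (hq0 : ∀ i, 0 ≤ q i) (hq1 : ∑ i, q i = 1)
    (hd0 : ∀ i, 0 ≤ d i) (hd1 : ∑ i, d i = 1)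
    (α : ℝ) (hα : 0 ≤ α) :
    ∃ S : Finset (Fin n),
      (∀ j ∈ S,
        q j * ((∑ j ∈ S, d j) * (Real.exp α - 1) + 1) >
        d j * ((∑ j ∈ S, q j) * (Real.exp α - 1) + 1)) ∧
      (∀ k ∉ S,
        q k * ((∑ j ∈ S, d j) * (Real.exp α - 1) + 1) ≤
        d k * ((∑ j ∈ S, q j) * (Real.exp α - 1) + 1)) := by
  have hc : 0 ≤ Real.exp α - 1 := sub_nonneg.2 (Real.one_le_exp hα)
  generalize Real.exp α - 1 = c at hc ⊢
  rcases hc.eq_or_lt with rfl | hc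
  · exact ⟨univ.filter fun j => d j < q j, by simp, by simp⟩
  have hD : ∀ T : Finset (Fin n), 0 < (∑ j ∈ T, d j) * c + 1 := fun T => by
    have := sum_nonneg fun i (_ : i ∈ T) => hd0 i
    positivity
  obtain ⟨S, hmax, herase⟩ := exists_max_forall_erase_lt
    fun T : Finset (Fin n) => ((∑ j ∈ T, q j) * c + 1) / ((∑ j ∈ T, d j) * c + 1)
  refine ⟨S, fun j hj => ?_, fun k hk => ?_⟩
  · have h := herase j hj
    rw [div_lt_div_iff₀ (hD _) (hD _), sum_erase_eq_sub hj, sum_erase_eq_sub hj] at h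
    refine lt_of_mul_lt_mul_left ?_ hc.le
    linarith
  · have h := hmax (insert k S)
    rw [div_le_div_iff₀ (hD _) (hD _), sum_insert hk, sum_insert hk] at h
    refine le_of_mul_le_mul_left ?_ hc
    linarith
end

section
/- Let q, d ∈ [0,1] with 0 < d < q ≤ 1 and let ε > 0. Define f(α) = log((q(e^α − 1) + 1)/(d(e^α − 1) + 1)) + ε and the sequence a₁ = ε, a_{t+1} = f(a_t) for t ≥ 1. Then the sequence (a_t) is monotone nondecreasing and converges, and its supremum equals log( (√(4·d·e^ε·(1 − q) + (d + q·e^ε − 1)²) + d + q·e^ε − 1) / (2d) ). -/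
open Real Filter

/-- The convex combination `c * x + (1 - c)` of `x > 0` and `1` is positive. -/
theorem mul_sub_one_add_one_pos {c x : ℝ} (hc : 0 < c) (hc1 : c ≤ 1) (hx : 0 < x) :
    0 < c * (x - 1) + 1 := by
  nlinarith [mul_pos hc hx]

/-- The leakage ratio is monotone on the positive reals. -/
theorem leakage_ratio_le {q d x y : ℝ} (hd : 0 < d) (hdq : d < q) (hq : q ≤ 1)
    (hx : 0 < x) (hxy : x ≤ y) :
    (q * (x - 1) + 1) / (d * (x - 1) + 1) ≤ (q * (y - 1) + 1) / (d * (y - 1) + 1) := by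
  rw [div_le_div_iff₀ (mul_sub_one_add_one_pos hd (by linarith) hx)
    (mul_sub_one_add_one_pos hd (by linarith) (hx.trans_le hxy))]
  nlinarith [mul_nonneg (sub_nonneg.2 hdq.le) (sub_nonneg.2 hxy)]

/-- The leakage ratio is bounded by the ratio of the row sums. -/
theorem leakage_ratio_le_div {q d x : ℝ} (hd : 0 < d) (hdq : d < q) (hq : q ≤ 1) (hx : 0 < x) :
    (q * (x - 1) + 1) / (d * (x - 1) + 1) ≤ q / d := by
  rw [div_le_div_iff₀ (mul_sub_one_add_one_pos hd (by linarith) hx) hd]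
  nlinarith

/-- The positive fixed point of `x ↦ E * (q * (x - 1) + 1) / (d * (x - 1) + 1)`. -/
theorem eq_of_leakage_fixed_point {q d E x : ℝ} (hd : 0 < d) (hq : q ≤ 1) (hE : 0 < E)
    (hx : 0 < x) (h : x * (d * (x - 1) + 1) = E * (q * (x - 1) + 1)) :
    x = (√(4 * d * E * (1 - q) + (d + q * E - 1) ^ 2) + d + q * E - 1) / (2 * d) := by
  have hlin : 0 ≤ d * x + (1 - d - q * E) := by
    refine nonneg_of_mul_nonneg_right ?_ hx
    nlinarith [mul_nonneg hE.le (sub_nonneg.2 hq)]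
  have hsqrt : √(4 * d * E * (1 - q) + (d + q * E - 1) ^ 2) = 2 * d * x + (1 - d - q * E) := by
    rw [show 4 * d * E * (1 - q) + (d + q * E - 1) ^ 2 = (2 * d * x + (1 - d - q * E)) ^ 2 by
      linear_combination (-4 * d) * h]
    exact Real.sqrt_sq (by nlinarith [mul_pos hd hx])
  rw [hsqrt]
  field_simp
  ring

/-- Note: the sequence is 0-indexed: `a 0` is the leakage at the first time point,
so `a 0 = ε` and `a (t+1) = f (a t)` for all `t`. -/
theorem stmt_6 (q d : ℝ) (hd : 0 < d) (hdq : d < q) (hq : q ≤ 1)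
    (ε : ℝ) (hε : 0 < ε)
    (f : ℝ → ℝ)
    (hf : f = fun α => Real.log ((q * (Real.exp α - 1) + 1) /
                                (d * (Real.exp α - 1) + 1)) + ε)
    (a : ℕ → ℝ) (ha0 : a 0 = ε) (harec : ∀ t, a (t + 1) = f (a t)) :
    Monotone a ∧ (∃ L : ℝ, Tendsto a atTop (nhds L)) ∧
    (⨆ t, a t) =
      Real.log ((Real.sqrt (4 * d * Real.exp ε * (1 - q) +
                  (d + q * Real.exp ε - 1) ^ 2) + d + q * Real.exp ε - 1) /
                (2 * d)) := by
  have hnum (α : ℝ) : 0 < q * (exp α - 1) + 1 :=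
    mul_sub_one_add_one_pos (hd.trans hdq) hq (exp_pos α)
  have hden (α : ℝ) : 0 < d * (exp α - 1) + 1 :=
    mul_sub_one_add_one_pos hd (by linarith) (exp_pos α)
  have hf_mono : Monotone f := by
    intro α β h
    simp only [hf]
    gcongr ?_ + ε
    exact Real.log_le_log (div_pos (hnum α) (hden α))
      (leakage_ratio_le hd hdq hq (exp_pos α) (exp_le_exp.2 h))
  have hf_cont : Continuous f := by
    rw [hf]
    refine Continuous.add (Continuous.log ?_ fun α => (div_pos (hnum α) (hden α)).ne')
      continuous_const
    exact Continuous.div (by fun_prop) (by fun_prop) fun α => (hden α).ne'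
  have hf_le (α : ℝ) : f α ≤ Real.log (q / d) + ε := by
    simp only [hf]
    gcongr ?_ + ε
    exact Real.log_le_log (div_pos (hnum α) (hden α)) (leakage_ratio_le_div hd hdq hq (exp_pos α))
  have hε_le : ε ≤ f ε := by
    have hzero : f 0 = ε := by simp [hf]
    exact hzero.ge.trans (hf_mono hε.le)
  have ha_mono : Monotone a := by
    refine monotone_nat_of_le_succ fun t => ?_
    induction t with
    | zero => rw [harec, ha0]; exact hε_le
    | succ t ih => rw [harec t, harec (t + 1)]; exact hf_mono ih
  have ha_bdd : BddAbove (Set.range a) := by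
    refine ⟨Real.log (q / d) + ε, ?_⟩
    rintro _ ⟨t, rfl⟩
    exact (ha_mono t.le_succ).trans ((harec t).trans_le (hf_le _))
  have hlim := tendsto_atTop_ciSup ha_mono ha_bdd
  refine ⟨ha_mono, ⟨_, hlim⟩, ?_⟩
  set L := ⨆ t, a t
  have hfix : f L = L := by
    refine tendsto_nhds_unique ((hf_cont.tendsto L).comp hlim) ?_
    simpa only [Function.comp_def, harec] using (tendsto_add_atTop_iff_nat 1).2 hlim
  have hexp : exp L * (d * (exp L - 1) + 1) = exp ε * (q * (exp L - 1) + 1) := by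
    have h : exp L = (q * (exp L - 1) + 1) / (d * (exp L - 1) + 1) * exp ε := by
      conv_lhs => rw [← hfix]
      simp only [hf]
      rw [exp_add, exp_log (div_pos (hnum L) (hden L))]
    rw [div_mul_eq_mul_div, eq_div_iff (hden L).ne'] at h
    rw [h, mul_comm]
  rw [← eq_of_leakage_fixed_point hd hq (exp_pos ε) (exp_pos L) hexp, Real.log_exp]
end

section
/- Let q ∈ (0,1) and ε > 0 with q·e^ε < 1. Define f(α) = log(q(e^α − 1) + 1) + ε and the sequence a₁ = ε, a_{t+1} = f(a_t) for t ≥ 1. Then the sequence (a_t) is monotone nondecreasing and converges, and its supremum equals log( (1 − q)·e^ε / (1 − q·e^ε) ). -/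
open Real Filter

theorem exp_log_affine_add {q : ℝ} (hq0 : 0 < q) (hq1 : q < 1) (ε α : ℝ) :
    Real.exp (Real.log (q * (Real.exp α - 1) + 1) + ε) =
      (q * (Real.exp α - 1) + 1) * Real.exp ε := by
  have hpos : 0 < q * (Real.exp α - 1) + 1 := by
    nlinarith [mul_pos hq0 (Real.exp_pos α)]
  rw [Real.exp_add, Real.exp_log hpos]

/-- Closed form of an affine recurrence in terms of a fixed point `c`. -/
theorem eq_sub_pow_mul_of_affine_rec {r b c : ℝ} (hc : c = r * c + b) {x : ℕ → ℝ}
    (hx : ∀ t, x (t + 1) = r * x t + b) (t : ℕ) : x t = c - r ^ t * (c - x 0) := by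
  induction t with
  | zero => simp
  | succ t ih => rw [hx, ih]; linear_combination (-1 : ℝ) * hc

/-- Note: the sequence is 0-indexed: `a 0 = ε` and `a (t+1) = f (a t)`. -/
theorem stmt_7 (q : ℝ) (hq0 : 0 < q) (hq1 : q < 1)
    (ε : ℝ) (hε : 0 < ε) (hqe : q * Real.exp ε < 1)
    (f : ℝ → ℝ)
    (hf : f = fun α => Real.log (q * (Real.exp α - 1) + 1) + ε)
    (a : ℕ → ℝ) (ha0 : a 0 = ε) (harec : ∀ t, a (t + 1) = f (a t)) :
    Monotone a ∧ (∃ L : ℝ, Tendsto a atTop (nhds L)) ∧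
    (⨆ t, a t) = Real.log ((1 - q) * Real.exp ε / (1 - q * Real.exp ε)) := by
  set E := Real.exp ε with hE
  set c := (1 - q) * E / (1 - q * E) with hc
  have hE1 : 1 < E := Real.one_lt_exp_iff.mpr hε
  have hE0 : 0 < E := Real.exp_pos ε
  have hden : 0 < 1 - q * E := sub_pos.mpr hqe
  have hr0 : 0 < q * E := mul_pos hq0 hE0
  have hc0 : 0 < c := div_pos (mul_pos (sub_pos.mpr hq1) hE0) hden
  have hfix : c = q * E * c + (1 - q) * E := by
    have : c * (1 - q * E) = (1 - q) * E := div_mul_cancel₀ _ hden.ne'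
    linarith
  have hEc : E ≤ c := by
    rw [hc, le_div_iff₀ hden]
    nlinarith [mul_pos hr0 (sub_pos.mpr hE1)]
  have hrec : ∀ t, Real.exp (a (t + 1)) = q * E * Real.exp (a t) + (1 - q) * E := by
    intro t
    rw [harec, hf]
    simp only
    rw [exp_log_affine_add hq0 hq1]
    ring
  have hclosed : ∀ t, Real.exp (a t) = c - (q * E) ^ t * (c - E) := by
    intro t
    rw [eq_sub_pow_mul_of_affine_rec (x := fun t => Real.exp (a t)) hfix hrec t, ha0]
  have hmono : Monotone a := by
    intro s t hst
    rw [← Real.exp_le_exp, hclosed, hclosed]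
    have hpow := pow_le_pow_of_le_one hr0.le hqe.le hst
    have := mul_le_mul_of_nonneg_right hpow (sub_nonneg.mpr hEc)
    linarith
  have hexp : Tendsto (fun t => Real.exp (a t)) atTop (nhds c) := by
    simp only [hclosed]
    simpa using
      ((tendsto_pow_atTop_nhds_zero_of_lt_one hr0.le hqe).mul_const (c - E)).const_sub c
  have hlim : Tendsto a atTop (nhds (Real.log c)) := by
    simpa using hexp.log hc0.ne'
  exact ⟨hmono, ⟨_, hlim⟩, (isLUB_of_tendsto_atTop hmono hlim).ciSup_eq⟩
end

section
/- Let q ∈ (0,1] and ε > 0 with q·e^ε ≥ 1. Define f(α) = log(q(e^α − 1) + 1) + ε and the sequence a₁ = ε, a_{t+1} = f(a_t) for t ≥ 1. Then the sequence (a_t) is unbounded above (it tends to +∞); in particular no finite supremum of the temporal privacy leakage exists. -/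
open Real Filter

/-- If `q * exp ε ≥ 1`, the exponential of the leakage grows at least linearly. -/
lemma one_add_mul_le_exp_leakage {q ε : ℝ} (hq0 : 0 < q) (hε : 0 < ε)
    (hqe : 1 ≤ q * Real.exp ε) {a : ℕ → ℝ} (ha0 : a 0 = ε)
    (harec : ∀ t, a (t + 1) = Real.log (q * (Real.exp (a t) - 1) + 1) + ε) (t : ℕ) :
    1 + t * (Real.exp ε - 1) ≤ Real.exp (a t) := by
  have hexp : 1 < Real.exp ε := Real.one_lt_exp_iff.mpr hε
  induction t with
  | zero => simp [ha0, hexp.le]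
  | succ t ih =>
    have hone : 1 ≤ Real.exp (a t) := by
      have : 0 ≤ (t : ℝ) * (Real.exp ε - 1) := mul_nonneg t.cast_nonneg (by linarith)
      linarith
    have hpos : 0 < q * (Real.exp (a t) - 1) + 1 := by
      have := mul_nonneg hq0.le (sub_nonneg.mpr hone)
      linarith
    rw [harec, Real.exp_add, Real.exp_log hpos]
    push_cast
    nlinarith [mul_nonneg (sub_nonneg.mpr hqe) (sub_nonneg.mpr hone)]

/-- Note: the sequence is 0-indexed: `a 0 = ε` and `a (t+1) = f (a t)`. -/
theorem stmt_8 (q : ℝ) (hq0 : 0 < q) (hq1 : q ≤ 1)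
    (ε : ℝ) (hε : 0 < ε) (hqe : 1 ≤ q * Real.exp ε)
    (f : ℝ → ℝ)
    (hf : f = fun α => Real.log (q * (Real.exp α - 1) + 1) + ε)
    (a : ℕ → ℝ) (ha0 : a 0 = ε) (harec : ∀ t, a (t + 1) = f (a t)) :
    Tendsto a atTop atTop ∧ ¬ BddAbove (Set.range a) := by
  subst hf
  have hlin : Tendsto (fun t : ℕ => 1 + (t : ℝ) * (Real.exp ε - 1)) atTop atTop :=
    tendsto_atTop_add_const_left _ _ <|
      tendsto_natCast_atTop_atTop.atTop_mul_const (sub_pos.mpr (Real.one_lt_exp_iff.mpr hε))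
  have hlim : Tendsto a atTop atTop := Real.tendsto_exp_comp_atTop.mp <|
    tendsto_atTop_mono (one_add_mul_le_exp_leakage hq0 hε hqe ha0 harec) hlin
  exact ⟨hlim, not_bddAbove_of_tendsto_atTop hlim⟩
end

section
/- Let q, d ∈ (0,1] and ε > 0, and set z* = (√(4·d·e^ε·(1 − q) + (d + q·e^ε − 1)²) + d + q·e^ε − 1) / (2d). Then z* > 1, z* is the unique real number z > 1 satisfying d·z² + (1 − d − q·e^ε)·z − e^ε·(1 − q) = 0, and consequently α* = log z* is the unique positive solution of the fixed-point equation α = log((q(e^α − 1) + 1)/(d(e^α − 1) + 1)) + ε. -/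
open Real

/-- A quadratic with positive leading coefficient and nonpositive constant term has at most one
positive root. -/
theorem eq_of_quadratic_roots_of_pos {a b c x y : ℝ} (ha : 0 < a) (hc : 0 ≤ c)
    (hx : 0 < x) (hy : 0 < y) (hxr : a * x ^ 2 + b * x - c = 0)
    (hyr : a * y ^ 2 + b * y - c = 0) : x = y := by
  have hfactor : (x - y) * (a * (x + y) + b) = 0 := by linear_combination hxr - hyr
  rcases mul_eq_zero.mp hfactor with h | h
  · linarith
  · have hprod : a * x * y = -c := by linear_combination x * h - hxr
    have hpos : 0 < a * x * y := by positivity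
    linarith

/-- For `α > 0` the fixed-point equation is the quadratic equation in `exp α`. -/
theorem fixedPoint_iff_quadratic_exp {q d ε α : ℝ} (hq : 0 ≤ q) (hd : 0 ≤ d) (hα : 0 < α) :
    α = log ((q * (exp α - 1) + 1) / (d * (exp α - 1) + 1)) + ε ↔
      d * exp α ^ 2 + (1 - d - q * exp ε) * exp α - exp ε * (1 - q) = 0 := by
  have hα' : 0 < exp α - 1 := sub_pos.mpr (one_lt_exp_iff.mpr hα)
  have hnum : 0 < q * (exp α - 1) + 1 := by positivity
  have hden : 0 < d * (exp α - 1) + 1 := by positivity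
  rw [← exp_eq_exp (x := α), exp_add, exp_log (div_pos hnum hden), div_mul_eq_mul_div,
    eq_div_iff hden.ne']
  constructor <;> intro h <;> linear_combination h

theorem stmt_9 (q d : ℝ) (hq0 : 0 < q) (hq1 : q ≤ 1) (hd0 : 0 < d) (hd1 : d ≤ 1)
    (ε : ℝ) (hε : 0 < ε)
    (zstar : ℝ)
    (hz : zstar = (Real.sqrt (4 * d * Real.exp ε * (1 - q) +
                    (d + q * Real.exp ε - 1) ^ 2) + d + q * Real.exp ε - 1) /
                  (2 * d)) :
    1 < zstar ∧
    (∀ z : ℝ, 1 < z →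
      (d * z ^ 2 + (1 - d - q * Real.exp ε) * z - Real.exp ε * (1 - q) = 0 ↔
       z = zstar)) ∧
    (∀ α : ℝ, 0 < α →
      (α = Real.log ((q * (Real.exp α - 1) + 1) /
                     (d * (Real.exp α - 1) + 1)) + ε ↔
       α = Real.log zstar)) := by
  
  have hE : 1 < exp ε := one_lt_exp_iff.mpr hε
  have hc : 0 ≤ exp ε * (1 - q) := mul_nonneg (exp_pos ε).le (sub_nonneg.mpr hq1)
  have hD : 0 ≤ 4 * d * exp ε * (1 - q) + (d + q * exp ε - 1) ^ 2 := by
    nlinarith [mul_nonneg hd0.le hc, sq_nonneg (d + q * exp ε - 1)]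
  have hgt : 1 < zstar := by
    have hsqrt : d + 1 - q * exp ε <
        √(4 * d * exp ε * (1 - q) + (d + q * exp ε - 1) ^ 2) := by
      apply lt_sqrt_of_sq_lt
      nlinarith [mul_pos hd0 (sub_pos.mpr hE)]
    rw [hz, lt_div_iff₀ (by positivity)]
    linarith
  have hroot : d * zstar ^ 2 + (1 - d - q * exp ε) * zstar - exp ε * (1 - q) = 0 := by
    have hs := sq_sqrt hD
    rw [hz]
    generalize √(4 * d * exp ε * (1 - q) + (d + q * exp ε - 1) ^ 2) = s at hs ⊢
    field_simp
    linear_combination hs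
  have hquad : ∀ z : ℝ, 1 < z →
      (d * z ^ 2 + (1 - d - q * exp ε) * z - exp ε * (1 - q) = 0 ↔ z = zstar) := by
    intro z hz1
    refine ⟨fun h => ?_, fun h => h ▸ hroot⟩
    exact eq_of_quadratic_roots_of_pos hd0 hc (by linarith) (by linarith) h hroot
  refine ⟨hgt, hquad, fun α hα => ?_⟩
  rw [fixedPoint_iff_quadratic_exp hq0.le hd0.le hα, hquad _ (one_lt_exp_iff.mpr hα),
    ← exp_eq_exp (y := log zstar), exp_log (by linarith)]
end

section
/- Let q, d ∈ [0,1] with d < q. Then the function α ↦ log((q(e^α − 1) + 1)/(d(e^α − 1) + 1)) is strictly increasing on [0, ∞). -/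
open Real

theorem stmt_10 (q d : ℝ) (hq : q ∈ Set.Icc (0:ℝ) 1) (hd : d ∈ Set.Icc (0:ℝ) 1)
    (hdq : d < q) :
    StrictMonoOn
      (fun α => Real.log ((q * (Real.exp α - 1) + 1) / (d * (Real.exp α - 1) + 1)))
      (Set.Ici (0:ℝ)) := by
  intro a ha b _ hab
  have hx : 0 ≤ Real.exp a - 1 := sub_nonneg.2 (Real.one_le_exp ha)
  have hxy : Real.exp a - 1 < Real.exp b - 1 := sub_lt_sub_right (Real.exp_lt_exp.2 hab) 1
  have pos : ∀ r x : ℝ, 0 ≤ r → 0 ≤ x → 0 < r * x + 1 := fun r x hr hx => by positivity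
  have hda := pos d _ hd.1 hx
  have hdb := pos d _ hd.1 (hx.trans hxy.le)
  refine Real.log_lt_log (div_pos (pos q _ hq.1 hx) hda) ?_
  rw [div_lt_div_iff₀ hda hdb]
  nlinarith [mul_pos (sub_pos.2 hdq) (sub_pos.2 hxy)]
end

section
/- Let n ≥ 1, let F ⊆ ℝⁿ be nonempty, let c, e ∈ ℝⁿ and c₀, e₀ ∈ ℝ, and define Q(x) = c·x + c₀ and D(x) = e·x + e₀, assuming D(x) > 0 for every x ∈ F. Let x* ∈ F and λ = Q(x*)/D(x*). Then x* maximizes Q(x)/D(x) over F (i.e., Q(x)/D(x) ≤ Q(x*)/D(x*) for all x ∈ F) if and only if 0 is the maximum of { Q(x) − λ·D(x) : x ∈ F }. -/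
open Finset

theorem stmt_12 (n : ℕ) (hn : 1 ≤ n) (F : Set (Fin n → ℝ)) (hF : F.Nonempty)
    (c e : Fin n → ℝ) (c₀ e₀ : ℝ)
    (Q D : (Fin n → ℝ) → ℝ)
    (hQ : Q = fun x => (∑ i, c i * x i) + c₀)
    (hD : D = fun x => (∑ i, e i * x i) + e₀)
    (hDpos : ∀ x ∈ F, 0 < D x)
    (xstar : Fin n → ℝ) (hx : xstar ∈ F)
    (lam : ℝ) (hlam : lam = Q xstar / D xstar) :
    (∀ x ∈ F, Q x / D x ≤ Q xstar / D xstar) ↔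
    IsGreatest ((fun x => Q x - lam * D x) '' F) 0 := by
  rw [← hlam]
  have hstar : Q xstar - lam * D xstar = 0 := by
    rw [hlam, div_mul_cancel₀ _ (hDpos xstar hx).ne', sub_self]
  constructor
  · intro h
    refine ⟨⟨xstar, hx, hstar⟩, ?_⟩
    rintro _ ⟨x, hxF, rfl⟩
    exact sub_nonpos.mpr ((div_le_iff₀ (hDpos x hxF)).mp (h x hxF))
  · intro h x hxF
    exact (div_le_iff₀ (hDpos x hxF)).mpr (sub_nonpos.mp (h.2 ⟨x, hxF, rfl⟩))
end

section
/- Let q, d ∈ [0,1] with d ≤ q and let ε ≥ 0. Define f(α) = log((q(e^α − 1) + 1)/(d(e^α − 1) + 1)) + ε and the sequence a₁ = ε, a_{t+1} = f(a_t) for t ≥ 1. Then for every t ≥ 1, ε ≤ a_t ≤ t·ε. -/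
open Real

/-- One step of the privacy-loss recursion adds a nonnegative amount of at most `α`. -/
theorem log_leakage_ratio_mem_Icc {q d α : ℝ} (hq : q ≤ 1) (hd : 0 ≤ d) (hdq : d ≤ q)
    (hα : 0 ≤ α) :
    Real.log ((q * (Real.exp α - 1) + 1) / (d * (Real.exp α - 1) + 1)) ∈ Set.Icc 0 α := by
  have hx : 0 ≤ Real.exp α - 1 := sub_nonneg.2 (Real.one_le_exp hα)
  have hden : 0 < d * (Real.exp α - 1) + 1 := by positivity
  have hone : 1 ≤ (q * (Real.exp α - 1) + 1) / (d * (Real.exp α - 1) + 1) := by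
    rw [one_le_div hden]
    gcongr
  refine ⟨Real.log_nonneg hone, (Real.log_le_iff_le_exp (by linarith)).2 ?_⟩
  rw [div_le_iff₀ hden]
  nlinarith [mul_le_mul_of_nonneg_right hq hx,
    mul_nonneg (Real.exp_pos α).le (mul_nonneg hd hx)]

/-- Note: the sequence is 0-indexed: `a 0 = ε` is the leakage at the first time
point (time 1), and `a t` is the leakage at time `t + 1`; the claimed bounds
read `ε ≤ a t ≤ (t + 1) · ε`. -/
theorem stmt_13 (q d : ℝ) (hq : q ∈ Set.Icc (0:ℝ) 1) (hd : d ∈ Set.Icc (0:ℝ) 1)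
    (hdq : d ≤ q) (ε : ℝ) (hε : 0 ≤ ε)
    (f : ℝ → ℝ)
    (hf : f = fun α => Real.log ((q * (Real.exp α - 1) + 1) /
                                (d * (Real.exp α - 1) + 1)) + ε)
    (a : ℕ → ℝ) (ha0 : a 0 = ε) (harec : ∀ t, a (t + 1) = f (a t)) :
    ∀ t : ℕ, ε ≤ a t ∧ a t ≤ (t + 1) * ε := by
  intro t
  induction t with
  | zero => simp [ha0]
  | succ t ih =>
    obtain ⟨hlow, hupp⟩ := ih
    obtain ⟨h0, h1⟩ := log_leakage_ratio_mem_Icc hq.2 hd.1 hdq (hε.trans hlow)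
    rw [harec, hf]
    push_cast
    constructor <;> linarith
end

section
/- Let q, d ∈ [0,1] with d ≤ q and (q, d) ≠ (1, 0), and let α > 0. Then log((q(e^α − 1) + 1)/(d(e^α − 1) + 1)) < α, strictly. -/
open Real

theorem stmt_14 (q d : ℝ) (hq : q ∈ Set.Icc (0:ℝ) 1) (hd : d ∈ Set.Icc (0:ℝ) 1)
    (hdq : d ≤ q) (hne : (q, d) ≠ (1, 0)) (α : ℝ) (hα : 0 < α) :
    Real.log ((q * (Real.exp α - 1) + 1) / (d * (Real.exp α - 1) + 1)) < α := by
  obtain ⟨hq0, hq1⟩ := hq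
  obtain ⟨hd0, -⟩ := hd
  have ht : 0 < Real.exp α - 1 := sub_pos.mpr (Real.one_lt_exp_iff.mpr hα)
  have hnum : 0 < q * (Real.exp α - 1) + 1 := by positivity
  have hden : 0 < d * (Real.exp α - 1) + 1 := by positivity
  rw [Real.log_lt_iff_lt_exp (div_pos hnum hden), div_lt_iff₀ hden]
  have hexpand : Real.exp α * (d * (Real.exp α - 1) + 1) - (q * (Real.exp α - 1) + 1)
      = (Real.exp α - 1) * ((1 - q) + d * Real.exp α) := by ring
  have hfactor : 0 < (1 - q) + d * Real.exp α := by
    rcases hd0.eq_or_lt with rfl | hd_pos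
    · have hq_lt : q < 1 := lt_of_le_of_ne hq1 fun h => hne (by rw [h])
      linarith
    · have := mul_pos hd_pos (Real.exp_pos α)
      linarith
  exact sub_pos.mp (hexpand ▸ mul_pos ht hfactor)
end

section
/- Let q, d ∈ [0,1] with d < q and (q, d) ≠ (1, 0), and let α > 0 be a target privacy level. Set ε = α − log((q(e^α − 1) + 1)/(d(e^α − 1) + 1)), define f(β) = log((q(e^β − 1) + 1)/(d(e^β − 1) + 1)) + ε, and define the sequence a₁ = ε, a_{t+1} = f(a_t) for t ≥ 1. Then ε > 0, f(α) = α, the sequence (a_t) is monotone nondecreasing, and a_t ≤ α for every t ≥ 1; hence the temporal privacy leakage never exceeds α regardless of the length of the release period. -/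
open Real

/-- The leakage increment is monotone on nonnegative inputs when `0 ≤ d ≤ q`. -/
lemma log_ratio_mono {q d x y : ℝ} (hd : 0 ≤ d) (hdq : d ≤ q) (hx : 0 ≤ x) (hxy : x ≤ y) :
    Real.log ((q * (Real.exp x - 1) + 1) / (d * (Real.exp x - 1) + 1)) ≤
      Real.log ((q * (Real.exp y - 1) + 1) / (d * (Real.exp y - 1) + 1)) := by
  have hX : 0 ≤ Real.exp x - 1 := sub_nonneg.2 (Real.one_le_exp hx)
  have hXY : Real.exp x - 1 ≤ Real.exp y - 1 := sub_le_sub_right (Real.exp_le_exp.2 hxy) 1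
  have hY := hX.trans hXY
  have hq : 0 ≤ q := hd.trans hdq
  generalize Real.exp x - 1 = X at *
  generalize Real.exp y - 1 = Y at *
  apply Real.log_le_log (by positivity)
  rw [div_le_div_iff₀ (by positivity) (by positivity)]
  nlinarith [mul_nonneg (sub_nonneg.2 hdq) (sub_nonneg.2 hXY)]

/-- Away from the extremal pair `(1, 0)`, the leakage increment is strictly below its input. -/
lemma log_ratio_lt_self {q d x : ℝ} (hq : 0 ≤ q) (hd : 0 ≤ d) (hlt : q - d < 1) (hx : 0 < x) :
    Real.log ((q * (Real.exp x - 1) + 1) / (d * (Real.exp x - 1) + 1)) < x := by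
  have hX : 0 < Real.exp x - 1 := sub_pos.2 (Real.one_lt_exp_iff.2 hx)
  rw [Real.log_lt_iff_lt_exp (by positivity), div_lt_iff₀ (by positivity)]
  nlinarith [mul_pos hX (sub_pos.2 hlt), mul_nonneg hd (sq_nonneg (Real.exp x - 1))]

/-- Note: the sequence is 0-indexed: `a 0 = ε` and `a (t+1) = f (a t)`. -/
theorem stmt_15 (q d : ℝ) (hq : q ∈ Set.Icc (0:ℝ) 1) (hd : d ∈ Set.Icc (0:ℝ) 1)
    (hdq : d < q) (hne : (q, d) ≠ (1, 0)) (α : ℝ) (hα : 0 < α)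
    (ε : ℝ)
    (hε : ε = α - Real.log ((q * (Real.exp α - 1) + 1) /
                            (d * (Real.exp α - 1) + 1)))
    (f : ℝ → ℝ)
    (hf : f = fun β => Real.log ((q * (Real.exp β - 1) + 1) /
                                (d * (Real.exp β - 1) + 1)) + ε)
    (a : ℕ → ℝ) (ha0 : a 0 = ε) (harec : ∀ t, a (t + 1) = f (a t)) :
    0 < ε ∧ f α = α ∧ Monotone a ∧ ∀ t, a t ≤ α := by
  obtain ⟨hq0, hq1⟩ := hq
  obtain ⟨hd0, -⟩ := hd
  have hlt : q - d < 1 := by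
    by_contra! h
    exact hne (Prod.ext (by linarith) (by linarith))
  have hε0 : 0 < ε := by
    rw [hε]
    exact sub_pos.2 (log_ratio_lt_self hq0 hd0 hlt hα)
  have hfα : f α = α := by simp [hf, hε]
  have hmono : ∀ {x y : ℝ}, 0 ≤ x → x ≤ y → f x ≤ f y := fun hx hxy => by
    simpa [hf] using log_ratio_mono hd0 hdq.le hx hxy
  have hf0 : f 0 = ε := by simp [hf]
  have hbound : ∀ t, 0 ≤ a t ∧ a t ≤ α := by
    intro t
    induction t with
    | zero => exact ⟨ha0 ▸ hε0.le, by rw [ha0, ← hf0, ← hfα]; exact hmono le_rfl (hfα.symm ▸ hα.le)⟩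
    | succ t ih =>
      rw [harec]
      exact ⟨hε0.le.trans (hf0 ▸ hmono le_rfl ih.1), (hmono ih.1 ih.2).trans_eq hfα⟩
  refine ⟨hε0, hfα, monotone_nat_of_le_succ fun t => ?_, fun t => (hbound t).2⟩
  induction t with
  | zero => rw [harec, ha0, ← hf0]; exact hmono le_rfl (hf0.symm ▸ hε0.le)
  | succ t ih =>
    rw [harec (t + 1), harec t]
    exact hmono (hbound t).1 (harec t ▸ ih)
end

section
/- Let n ≥ 1, let q, d ∈ ℝⁿ be probability vectors and let α ≥ 0. Then the supremum of (Σᵢ q_i x_i)/(Σᵢ d_i x_i) over the feasible region F(α) equals the maximum over all subsets S ⊆ {1,…,n} of the quantity ( (Σ_{j∈S} q_j)·(e^α − 1) + 1 ) / ( (Σ_{j∈S} d_j)·(e^α − 1) + 1 ), and this supremum is attained by some x ∈ F(α). -/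
open Real Finset

/-- The weighted sum of a vector taking the value `E * t` on `S` and `t` elsewhere. -/
lemma sum_mul_two_valued {ι : Type*} [Fintype ι] [DecidableEq ι] (w : ι → ℝ) (S : Finset ι)
    (E t : ℝ) :
    ∑ i, w i * (if i ∈ S then E * t else t) = t * ((∑ j ∈ S, w j) * (E - 1) + ∑ i, w i) := by
  have h : ∀ i, w i * (if i ∈ S then E * t else t)
      = t * (E - 1) * (if i ∈ S then w i else 0) + t * w i := by
    intro i
    split_ifs <;> ring
  simp only [h, Finset.sum_add_distrib, ← Finset.mul_sum, Finset.sum_ite_mem, Finset.univ_inter]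
  ring

theorem stmt_16 (n : ℕ) (hn : 1 ≤ n) (q d : Fin n → ℝ)
    (hq0 : ∀ i, 0 ≤ q i) (hq1 : ∑ i, q i = 1)
    (hd0 : ∀ i, 0 ≤ d i) (hd1 : ∑ i, d i = 1)
    (α : ℝ) (hα : 0 ≤ α) :
    IsGreatest ((fun x => (∑ i, q i * x i) / (∑ i, d i * x i)) '' feasible n α)
      (⨆ S : Finset (Fin n),
        ((∑ j ∈ S, q j) * (Real.exp α - 1) + 1) /
        ((∑ j ∈ S, d j) * (Real.exp α - 1) + 1)) := by
  have hE : 1 ≤ Real.exp α := Real.one_le_exp hα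
  have hD : ∀ S : Finset (Fin n), 0 < (∑ j ∈ S, d j) * (Real.exp α - 1) + 1 := fun S =>
    add_pos_of_nonneg_of_pos
      (mul_nonneg (Finset.sum_nonneg fun i _ => hd0 i) (sub_nonneg.2 hE)) one_pos
  have : Nonempty (Fin n) := ⟨⟨0, hn⟩⟩
  constructor
  · obtain ⟨S, hS⟩ := exists_eq_ciSup_of_finite (f := fun S : Finset (Fin n) =>
      ((∑ j ∈ S, q j) * (Real.exp α - 1) + 1) / ((∑ j ∈ S, d j) * (Real.exp α - 1) + 1))
    rw [← hS]
    obtain ⟨t, ht, hEt⟩ : ∃ t : ℝ, 0 < t ∧ Real.exp α * t = 1 / 2 :=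
      ⟨1 / (2 * Real.exp α), by positivity, by field_simp⟩
    have hle : t ≤ 1 / 2 := hEt ▸ le_mul_of_one_le_left ht.le hE
    refine ⟨fun i => if i ∈ S then Real.exp α * t else t, ⟨fun i => ?_, fun j k => ?_⟩, ?_⟩
    · dsimp only
      split_ifs <;> constructor <;> linarith
    · dsimp only
      split_ifs <;> nlinarith
    · simp only [sum_mul_two_valued, hq1, hd1]
      exact mul_div_mul_left _ _ ht.ne'
  · rintro _ ⟨x, ⟨hx, hxr⟩, rfl⟩
    set R := ⨆ S : Finset (Fin n),
        ((∑ j ∈ S, q j) * (Real.exp α - 1) + 1) / ((∑ j ∈ S, d j) * (Real.exp α - 1) + 1)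
    have hR : ∀ S : Finset (Fin n), (∑ j ∈ S, q j) * (Real.exp α - 1) + 1
        ≤ R * ((∑ j ∈ S, d j) * (Real.exp α - 1) + 1) := fun S =>
      (div_le_iff₀ (hD S)).1 (le_ciSup (f := fun S : Finset (Fin n) =>
        ((∑ j ∈ S, q j) * (Real.exp α - 1) + 1) / ((∑ j ∈ S, d j) * (Real.exp α - 1) + 1))
        (Set.finite_range _).bddAbove S)
    obtain ⟨k, hk⟩ := Finite.exists_min x
    have hpos : 0 < ∑ i, d i * x i :=
      calc 0 < x k := (hx k).1
        _ = ∑ i, d i * x k := by rw [← Finset.sum_mul, hd1, one_mul]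
        _ ≤ ∑ i, d i * x i :=
          Finset.sum_le_sum fun i _ => mul_le_mul_of_nonneg_left (hk i) (hd0 i)
    dsimp only
    rw [div_le_iff₀ hpos]
    let S : Finset (Fin n) := {i | 0 < q i - R * d i}
    have hsum : ∑ i, (q i - R * d i) * x i
        ≤ ∑ i, (q i - R * d i) * (if i ∈ S then Real.exp α * x k else x k) := by
      refine Finset.sum_le_sum fun i _ => ?_
      split_ifs with hi
      · exact mul_le_mul_of_nonneg_left (hxr i k) (Finset.mem_filter.1 hi).2.le
      · refine mul_le_mul_of_nonpos_left (hk i) (not_lt.1 fun h => hi ?_)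
        exact Finset.mem_filter.2 ⟨Finset.mem_univ i, h⟩
    rw [sum_mul_two_valued] at hsum
    simp only [sub_mul, Finset.sum_sub_distrib, mul_assoc, ← Finset.mul_sum, hq1, hd1] at hsum
    have hnonpos := mul_nonneg (hx k).1.le (sub_nonneg.2 (hR S))
    linarith
end
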